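/- Let p ≥ 5 be a prime and let I₁ be the pro-p Iwahori subgroup of SL₂(ℤ_p), i.e. the subgroup of matrices A ∈ SL₂(ℤ_p) with A₀₀ − 1 ∈ pℤ_p, A₁₁ − 1 ∈ pℤ_p and A₁₀ ∈ pℤ_p. Then for every a ∈ ℤ_p with a − 1 ∈ pℤ_p (so a is a unit of ℤ_p), the diagonal matrix !![a, 0; 0, a⁻¹] lies in the commutator subgroup of I₁. -/

import Mathlib

open Matrix

/-- The pro-`p` Iwahori subgroup of `SL₂(ℤ_p)`: matrices that are upper-triangular
unipotent mod `p`. -/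
def proPIwahori (p : ℕ) [Fact p.Prime] : Subgroup (Matrix.SpecialLinearGroup (Fin 2) ℤ_[p]) where
  carrier := {A | (p : ℤ_[p]) ∣ ((A : Matrix (Fin 2) (Fin 2) ℤ_[p]) 0 0 - 1) ∧
    (p : ℤ_[p]) ∣ ((A : Matrix (Fin 2) (Fin 2) ℤ_[p]) 1 1 - 1) ∧
    (p : ℤ_[p]) ∣ ((A : Matrix (Fin 2) (Fin 2) ℤ_[p]) 1 0)}
  one_mem' := by
    simp [Matrix.SpecialLinearGroup.coe_one, Matrix.one_apply]
  mul_mem' := by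
    rintro A B ⟨hA1, hA2, hA3⟩ ⟨hB1, hB2, hB3⟩
    simp only [Set.mem_setOf_eq, Matrix.SpecialLinearGroup.coe_mul, Matrix.mul_apply,
      Fin.sum_univ_two] at *
    refine ⟨?_, ?_, ?_⟩
    · have h : (A : Matrix (Fin 2) (Fin 2) ℤ_[p]) 0 0 * (B : Matrix (Fin 2) (Fin 2) ℤ_[p]) 0 0 +
          (A : Matrix (Fin 2) (Fin 2) ℤ_[p]) 0 1 * (B : Matrix (Fin 2) (Fin 2) ℤ_[p]) 1 0 - 1 =
          ((A : Matrix (Fin 2) (Fin 2) ℤ_[p]) 0 0 - 1) * (B : Matrix (Fin 2) (Fin 2) ℤ_[p]) 0 0 +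
          ((B : Matrix (Fin 2) (Fin 2) ℤ_[p]) 0 0 - 1) +
          (A : Matrix (Fin 2) (Fin 2) ℤ_[p]) 0 1 * (B : Matrix (Fin 2) (Fin 2) ℤ_[p]) 1 0 := by
        ring
      rw [h]
      exact dvd_add (dvd_add (hA1.mul_right _) hB1) (hB3.mul_left _)
    · have h : (A : Matrix (Fin 2) (Fin 2) ℤ_[p]) 1 0 * (B : Matrix (Fin 2) (Fin 2) ℤ_[p]) 0 1 +
          (A : Matrix (Fin 2) (Fin 2) ℤ_[p]) 1 1 * (B : Matrix (Fin 2) (Fin 2) ℤ_[p]) 1 1 - 1 =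
          (A : Matrix (Fin 2) (Fin 2) ℤ_[p]) 1 0 * (B : Matrix (Fin 2) (Fin 2) ℤ_[p]) 0 1 +
          ((A : Matrix (Fin 2) (Fin 2) ℤ_[p]) 1 1 - 1) * (B : Matrix (Fin 2) (Fin 2) ℤ_[p]) 1 1 +
          ((B : Matrix (Fin 2) (Fin 2) ℤ_[p]) 1 1 - 1) := by
        ring
      rw [h]
      exact dvd_add (dvd_add (hA3.mul_right _) (hA2.mul_right _)) hB2
    · exact dvd_add (hA3.mul_right _) (hB3.mul_left _)
  inv_mem' := by
    rintro A ⟨hA1, hA2, hA3⟩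
    rw [Matrix.SpecialLinearGroup.SL2_inv_expl]
    refine ⟨?_, ?_, ?_⟩ <;> simp [hA1, hA2, hA3]

namespace Matrix.SpecialLinearGroup

open scoped commutatorElement

variable {R : Type*} [CommRing R]

/-- The upper-triangular unipotent matrix `!![1, x; 0, 1]`. -/
def upperUnipotent (x : R) : SpecialLinearGroup (Fin 2) R :=
  ⟨!![1, x; 0, 1], by simp [det_fin_two_of]⟩

/-- The lower-triangular unipotent matrix `!![1, 0; x, 1]`. -/
def lowerUnipotent (x : R) : SpecialLinearGroup (Fin 2) R :=
  ⟨!![1, 0; x, 1], by simp [det_fin_two_of]⟩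

/-- The diagonal matrix `!![t, 0; 0, t⁻¹]`. -/
def diagUnit (t : Rˣ) : SpecialLinearGroup (Fin 2) R :=
  ⟨!![(t : R), 0; 0, ((t⁻¹ : Rˣ) : R)], by simp [det_fin_two_of]⟩

@[simp]
theorem coe_upperUnipotent (x : R) : (upperUnipotent x : Matrix (Fin 2) (Fin 2) R) =
    !![1, x; 0, 1] :=
  rfl

@[simp]
theorem coe_lowerUnipotent (x : R) : (lowerUnipotent x : Matrix (Fin 2) (Fin 2) R) =
    !![1, 0; x, 1] :=
  rfl

@[simp]
theorem coe_diagUnit (t : Rˣ) : (diagUnit t : Matrix (Fin 2) (Fin 2) R) =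
    !![(t : R), 0; 0, ((t⁻¹ : Rˣ) : R)] :=
  rfl

theorem diagUnit_inv (t : Rˣ) : diagUnit t⁻¹ = (diagUnit t)⁻¹ := by
  rw [eq_inv_iff_mul_eq_one]
  ext i j
  fin_cases i <;> fin_cases j <;> simp

theorem commutatorElement_diagUnit_upperUnipotent (t : Rˣ) (x : R) :
    ⁅diagUnit t, upperUnipotent x⁆ = upperUnipotent (((t : R) ^ 2 - 1) * x) := by
  rw [commutatorElement_def, mul_inv_eq_iff_eq_mul, mul_inv_eq_iff_eq_mul]
  ext i j
  fin_cases i <;> fin_cases j <;> simp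
  linear_combination (-(t : R) * x) * t.mul_inv

theorem commutatorElement_diagUnit_inv_lowerUnipotent (t : Rˣ) (x : R) :
    ⁅diagUnit t⁻¹, lowerUnipotent x⁆ = lowerUnipotent (((t : R) ^ 2 - 1) * x) := by
  rw [commutatorElement_def, mul_inv_eq_iff_eq_mul, mul_inv_eq_iff_eq_mul]
  ext i j
  fin_cases i <;> fin_cases j <;> simp
  linear_combination (-(t : R) * x) * t.mul_inv

/-- The factorization of the commutator of a lower and an upper unipotent matrix. -/
theorem commutatorElement_lowerUnipotent_upperUnipotent {x y : R} (t : Rˣ)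
    (ht : (t : R) = 1 - x * y) :
    ⁅lowerUnipotent x, upperUnipotent y⁆ =
      lowerUnipotent (-x ^ 2 * y * (t⁻¹ : Rˣ)) * diagUnit t *
        upperUnipotent (x * y ^ 2 * (t⁻¹ : Rˣ)) := by
  have h := t.mul_inv
  rw [commutatorElement_def, mul_inv_eq_iff_eq_mul, mul_inv_eq_iff_eq_mul]
  ext i j
  fin_cases i <;> fin_cases j <;> simp
  all_goals grind

end Matrix.SpecialLinearGroup

open Matrix.SpecialLinearGroup

theorem PadicInt.isUnit_of_dvd_sub_one {p : ℕ} [Fact p.Prime] {z : ℤ_[p]}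
    (hz : (p : ℤ_[p]) ∣ z - 1) : IsUnit z := by
  by_contra h
  have hd := (PadicInt.norm_lt_one_iff_dvd z).1 (PadicInt.not_isUnit_iff.1 h)
  exact PadicInt.prime_p.not_dvd_one (by simpa using dvd_sub hd hz)

theorem PadicInt.isUnit_two_add_p {p : ℕ} [Fact p.Prime] (hp : p ≠ 2) :
    IsUnit (2 + p : ℤ_[p]) := by
  by_contra h
  have hd := (PadicInt.norm_lt_one_iff_dvd _).1 (PadicInt.not_isUnit_iff.1 h)
  have h2 : ‖((2 : ℤ) : ℤ_[p])‖ < 1 :=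
    (PadicInt.norm_lt_one_iff_dvd _).2 (by simpa using hd)
  have h3 : p ∣ 2 := by exact_mod_cast (PadicInt.norm_int_lt_one_iff_dvd 2).1 h2
  exact hp ((Nat.prime_dvd_prime_iff_eq Fact.out Nat.prime_two).1 h3)

section

variable {p : ℕ} [Fact p.Prime]

theorem upperUnipotent_mem_proPIwahori (x : ℤ_[p]) : upperUnipotent x ∈ proPIwahori p := by
  refine ⟨?_, ?_, ?_⟩ <;> simp

theorem lowerUnipotent_mem_proPIwahori {x : ℤ_[p]} (hx : (p : ℤ_[p]) ∣ x) :
    lowerUnipotent x ∈ proPIwahori p := by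
  refine ⟨?_, ?_, ?_⟩ <;> simp [hx]

theorem diagUnit_mem_proPIwahori {t : ℤ_[p]ˣ} (ht : (p : ℤ_[p]) ∣ t - 1) :
    diagUnit t ∈ proPIwahori p := by
  refine ⟨by simpa using ht, ?_, by simp⟩
  have h : ((t⁻¹ : ℤ_[p]ˣ) : ℤ_[p]) - 1 = -(t⁻¹ : ℤ_[p]ˣ) * (t - 1) := by
    linear_combination t.inv_mul
  simpa [h] using ht

/-- For odd `p`, some `t ≡ 1 mod p` has `t ^ 2 - 1` equal to `p` up to a unit. -/
theorem exists_unit_sq_sub_one_eq (hp : p ≠ 2) :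
    ∃ t v : ℤ_[p]ˣ, (p : ℤ_[p]) ∣ t - 1 ∧ (t : ℤ_[p]) ^ 2 - 1 = p * v := by
  obtain ⟨t, ht⟩ := PadicInt.isUnit_of_dvd_sub_one (z := 1 + (p : ℤ_[p])) (by simp)
  obtain ⟨v, hv⟩ := PadicInt.isUnit_two_add_p hp
  exact ⟨t, v, by simp [ht], by rw [ht, hv]; ring⟩

theorem upperUnipotent_mem_commutator_proPIwahori (hp : p ≠ 2) {x : ℤ_[p]}
    (hx : (p : ℤ_[p]) ∣ x) : upperUnipotent x ∈ ⁅proPIwahori p, proPIwahori p⁆ := by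
  obtain ⟨t, v, ht, htv⟩ := exists_unit_sq_sub_one_eq hp
  obtain ⟨z, rfl⟩ := hx
  have h := Subgroup.commutator_mem_commutator (diagUnit_mem_proPIwahori ht)
    (upperUnipotent_mem_proPIwahori ((v⁻¹ : ℤ_[p]ˣ).val * z))
  rwa [commutatorElement_diagUnit_upperUnipotent, htv, mul_assoc, Units.mul_inv_cancel_left] at h

theorem lowerUnipotent_mem_commutator_proPIwahori (hp : p ≠ 2) {x : ℤ_[p]}
    (hx : (p : ℤ_[p]) ^ 2 ∣ x) : lowerUnipotent x ∈ ⁅proPIwahori p, proPIwahori p⁆ := by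
  obtain ⟨t, v, ht, htv⟩ := exists_unit_sq_sub_one_eq hp
  obtain ⟨z, rfl⟩ := hx
  have h := Subgroup.commutator_mem_commutator
    (inv_mem (diagUnit_mem_proPIwahori ht))
    (lowerUnipotent_mem_proPIwahori (x := (v⁻¹ : ℤ_[p]ˣ).val * ((p : ℤ_[p]) * z))
      (Dvd.intro _ rfl |>.mul_left _))
  rwa [← diagUnit_inv, commutatorElement_diagUnit_inv_lowerUnipotent, htv, mul_assoc,
    Units.mul_inv_cancel_left, ← mul_assoc, ← sq] at h

end

/-- Step (c) of the proof of Lemma 5.1 of the paper, for `SL₂(ℚ_p)`: for every unit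
`a` of `ℤ_p` with `a − 1 ∈ pℤ_p`, the diagonal matrix `!![a, 0; 0, a⁻¹]` lies in the
commutator subgroup of the pro-`p` Iwahori subgroup `I₁`. -/
theorem diagonal_mem_commutator_proPIwahori (p : ℕ) [Fact p.Prime] (hp : 5 ≤ p)
    (a : ℤ_[p]ˣ) (ha : (p : ℤ_[p]) ∣ ((a : ℤ_[p]) - 1)) :
    (⟨!![(a : ℤ_[p]), 0; 0, ((a⁻¹ : ℤ_[p]ˣ) : ℤ_[p])],
        by simp [Matrix.det_fin_two_of]⟩ :
      Matrix.SpecialLinearGroup (Fin 2) ℤ_[p]) ∈ ⁅proPIwahori p, proPIwahori p⁆ := by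
  have hp2 : p ≠ 2 := by omega
  have ha' : (p : ℤ_[p]) ∣ 1 - a := dvd_sub_comm.1 ha
  have hc := Subgroup.commutator_mem_commutator (lowerUnipotent_mem_proPIwahori ha')
    (upperUnipotent_mem_proPIwahori 1)
  rw [commutatorElement_lowerUnipotent_upperUnipotent a (by ring)] at hc
  rw [Subgroup.mul_mem_cancel_right _ (upperUnipotent_mem_commutator_proPIwahori hp2 ?_),
    Subgroup.mul_mem_cancel_left _ (lowerUnipotent_mem_commutator_proPIwahori hp2 ?_)] at hc
  · exact hc
  · simpa using pow_dvd_pow_of_dvd ha' 2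
  · simpa using ha'
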